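/- arXiv:2504.00545 — 2 statements merged into one kernel-verified Lean document; each statement's English description precedes it below -/
import Mathlib

section
/- For fixed α, β > 0, the quantity d_{α,β}(z,0) = ∫_{ℂⁿ} |e^{β z·ū} − 1| dλ_α(u) satisfies the two-sided estimate d_{α,β}(z,0) ≍ √(e^{β²|z|²/(2α)} − 1): there exist constants c, C > 0 such that c√(e^{β²|z|²/(2α)} − 1) ≤ d_{α,β}(z,0) ≤ C√(e^{β²|z|²/(2α)} − 1) for all z ∈ ℂⁿ. -/
open MeasureTheory
open scoped InnerProductSpace

/-- `ℂⁿ` carries the Lebesgue volume measure (as a finite-dimensional real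
inner product space). -/
noncomputable instance (n : ℕ) : MeasureSpace (EuclideanSpace ℂ (Fin n)) := by
  borelize (EuclideanSpace ℂ (Fin n))
  exact measureSpaceOfInnerProductSpace

/-- The Gaussian density `(α/π)^n e^{-α|u|²}` on `ℂⁿ`, so that
`dλ_α = gaussDensity n α ∂v`. -/
noncomputable def gaussDensity (n : ℕ) (α : ℝ) (u : EuclideanSpace ℂ (Fin n)) : ℝ :=
  (α / Real.pi) ^ n * Real.exp (-α * ‖u‖ ^ 2)

/-- `d_{α,β}(z,w) = ∫_{ℂⁿ} |e^{β z·ū} - e^{β w·ū}| dλ_α(u)`.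
Note `z·ū = z₁ū₁ + ⋯ + zₙūₙ = ⟪u, z⟫_ℂ` in Mathlib's convention. -/
noncomputable def dAB (n : ℕ) (α β : ℝ) (z w : EuclideanSpace ℂ (Fin n)) : ℝ :=
  ∫ u, ‖Complex.exp ((β : ℂ) * ⟪u, z⟫_ℂ) - Complex.exp ((β : ℂ) * ⟪u, w⟫_ℂ)‖ *
    gaussDensity n α u

section InnerProductSpace

variable {V : Type*} [NormedAddCommGroup V]

/-- The density of the normalized Gaussian measure on a `2n`-dimensional real space. -/
noncomputable def gaussWeight (n : ℕ) (α : ℝ) (u : V) : ℝ :=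
  (α / Real.pi) ^ n * Real.exp (-α * ‖u‖ ^ 2)

lemma gaussWeight_nonneg (n : ℕ) {α : ℝ} (hα : 0 < α) (u : V) :
    0 ≤ gaussWeight n α u := by
  unfold gaussWeight; positivity

variable [InnerProductSpace ℝ V]

lemma cexp_mul_gaussWeight (n : ℕ) (α : ℝ) (c : ℂ) (w u : V) :
    Complex.exp (c * (⟪w, u⟫_ℝ : ℝ)) * (gaussWeight n α u : ℂ) =
      ((α / Real.pi : ℝ) : ℂ) ^ n *
        Complex.exp (-(α : ℂ) * (‖u‖ : ℂ) ^ 2 + c * (⟪w, u⟫_ℝ : ℝ)) := by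
  rw [gaussWeight, Complex.exp_add]
  push_cast
  ring

lemma ofReal_exp_mul_gaussWeight (n : ℕ) (α s : ℝ) (w u : V) :
    ((Real.exp (s * ⟪w, u⟫_ℝ) * gaussWeight n α u : ℝ) : ℂ) =
      Complex.exp ((s : ℂ) * (⟪w, u⟫_ℝ : ℝ)) * (gaussWeight n α u : ℂ) := by
  push_cast; rfl

variable [FiniteDimensional ℝ V] [MeasurableSpace V] [BorelSpace V]

lemma integrable_cexp_mul_gaussWeight (n : ℕ) {α : ℝ} (hα : 0 < α) (c : ℂ) (w : V) :
    Integrable fun u : V ↦ Complex.exp (c * (⟪w, u⟫_ℝ : ℝ)) * (gaussWeight n α u : ℂ) := by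
  simp_rw [cexp_mul_gaussWeight]
  exact (GaussianFourier.integrable_cexp_neg_mul_sq_norm_add (by simpa using hα) c w).const_mul _

lemma integral_cexp_mul_gaussWeight {n : ℕ} (hn : Module.finrank ℝ V = 2 * n)
    {α : ℝ} (hα : 0 < α) (c : ℂ) (w : V) :
    ∫ u : V, Complex.exp (c * (⟪w, u⟫_ℝ : ℝ)) * (gaussWeight n α u : ℂ) =
      Complex.exp (c ^ 2 * ‖w‖ ^ 2 / (4 * α)) := by
  simp_rw [cexp_mul_gaussWeight]
  rw [integral_const_mul, GaussianFourier.integral_cexp_neg_mul_sq_norm_add (by simpa using hα),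
    hn]
  have h : ((2 * n : ℕ) : ℂ) / 2 = (n : ℂ) := by push_cast; ring
  have hα' : (α : ℂ) ≠ 0 := by exact_mod_cast hα.ne'
  have hπ : (Real.pi : ℂ) ≠ 0 := by exact_mod_cast Real.pi_ne_zero
  rw [h, Complex.cpow_natCast, ← mul_assoc, ← mul_pow]
  push_cast
  rw [div_mul_div_comm, mul_comm (α : ℂ), div_self (by positivity), one_pow, one_mul]

lemma integrable_exp_mul_gaussWeight (n : ℕ) {α : ℝ} (hα : 0 < α) (s : ℝ) (w : V) :
    Integrable fun u : V ↦ Real.exp (s * ⟪w, u⟫_ℝ) * gaussWeight n α u := by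
  refine (integrable_cexp_mul_gaussWeight n hα s w).re.congr (.of_forall fun u ↦ ?_)
  simp only [← ofReal_exp_mul_gaussWeight]
  exact Complex.ofReal_re _

lemma integral_exp_mul_gaussWeight {n : ℕ} (hn : Module.finrank ℝ V = 2 * n)
    {α : ℝ} (hα : 0 < α) (s : ℝ) (w : V) :
    ∫ u : V, Real.exp (s * ⟪w, u⟫_ℝ) * gaussWeight n α u =
      Real.exp (s ^ 2 * ‖w‖ ^ 2 / (4 * α)) := by
  have h := integral_cexp_mul_gaussWeight hn hα (s : ℂ) w
  simp_rw [← ofReal_exp_mul_gaussWeight] at h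
  rw [integral_complex_ofReal] at h
  exact_mod_cast h

lemma integrable_gaussWeight (n : ℕ) {α : ℝ} (hα : 0 < α) :
    Integrable (gaussWeight n α : V → ℝ) := by
  simpa using integrable_exp_mul_gaussWeight n hα 0 (0 : V)

lemma integral_gaussWeight {n : ℕ} (hn : Module.finrank ℝ V = 2 * n)
    {α : ℝ} (hα : 0 < α) : ∫ u : V, gaussWeight n α u = 1 := by
  simpa using integral_exp_mul_gaussWeight hn hα 0 (0 : V)

lemma integrable_norm_mul_exp_mul_gaussWeight (n : ℕ) {α : ℝ} (hα : 0 < α) (t : ℝ) :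
    Integrable fun u : V ↦ ‖u‖ * Real.exp (t * ‖u‖) * gaussWeight n α u := by
  have hint := ((integrable_gaussWeight (V := V) 0 (half_pos hα)).const_mul
    ((α / Real.pi) ^ n * Real.exp ((1 + t) ^ 2 / (2 * α))))
  refine hint.mono' (by unfold gaussWeight; fun_prop) (.of_forall fun u ↦ ?_)
  have h1 : ‖u‖ ≤ Real.exp ‖u‖ := by linarith [Real.add_one_le_exp ‖u‖]
  have h2 : ‖u‖ + t * ‖u‖ + -α * ‖u‖ ^ 2 ≤ (1 + t) ^ 2 / (2 * α) + -(α / 2) * ‖u‖ ^ 2 := by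
    have : (1 + t) ^ 2 / (2 * α) + -(α / 2) * ‖u‖ ^ 2 - (‖u‖ + t * ‖u‖ + -α * ‖u‖ ^ 2) =
        (1 + t - α * ‖u‖) ^ 2 / (2 * α) := by field_simp; ring
    have : 0 ≤ (1 + t - α * ‖u‖) ^ 2 / (2 * α) := by positivity
    linarith
  rw [Real.norm_of_nonneg (by have := gaussWeight_nonneg n hα u; positivity)]
  unfold gaussWeight
  calc ‖u‖ * Real.exp (t * ‖u‖) * ((α / Real.pi) ^ n * Real.exp (-α * ‖u‖ ^ 2))
      ≤ Real.exp ‖u‖ * Real.exp (t * ‖u‖) *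
          ((α / Real.pi) ^ n * Real.exp (-α * ‖u‖ ^ 2)) := by gcongr
    _ = (α / Real.pi) ^ n * Real.exp (‖u‖ + t * ‖u‖ + -α * ‖u‖ ^ 2) := by
        rw [Real.exp_add, Real.exp_add]; ring
    _ ≤ (α / Real.pi) ^ n * Real.exp ((1 + t) ^ 2 / (2 * α) + -(α / 2) * ‖u‖ ^ 2) := by gcongr
    _ = _ := by rw [Real.exp_add]; ring

/-- Testing `e^{s⟪w,u⟫} - 1` against the character `e^{i⟪w,u⟫}` of the unit vector `w`. -/
lemma sin_le_integral_abs_exp_sub_one {n : ℕ} (hn : Module.finrank ℝ V = 2 * n)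
    {α : ℝ} (hα : 0 < α) {s : ℝ} {w : V} (hw : ‖w‖ = 1)
    (hsin : 0 ≤ Real.sin (s / (2 * α))) :
    Real.exp (-1 / (4 * α)) * Real.sin (s / (2 * α)) ≤
      ∫ u : V, |Real.exp (s * ⟪w, u⟫_ℝ) - 1| * gaussWeight n α u := by
  have hαC : (α : ℂ) ≠ 0 := by exact_mod_cast hα.ne'
  set A := ∫ u : V, (Complex.exp ((s + Complex.I) * (⟪w, u⟫_ℝ : ℝ)) * (gaussWeight n α u : ℂ) -
    Complex.exp (Complex.I * (⟪w, u⟫_ℝ : ℝ)) * (gaussWeight n α u : ℂ)) with hA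
  have hAval : A = ((Real.exp (-1 / (4 * α)) : ℝ) : ℂ) *
      (Complex.exp (((s ^ 2 / (4 * α) : ℝ) : ℂ) + ((s / (2 * α) : ℝ) : ℂ) * Complex.I) - 1) := by
    rw [hA, integral_sub (integrable_cexp_mul_gaussWeight n hα _ w)
      (integrable_cexp_mul_gaussWeight n hα _ w), integral_cexp_mul_gaussWeight hn hα,
      integral_cexp_mul_gaussWeight hn hα, hw, Complex.ofReal_exp, mul_sub, ← Complex.exp_add,
      mul_one]
    congr 2
    · push_cast
      field_simp
      linear_combination 2 * Complex.I_sq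
    · push_cast
      rw [Complex.I_sq]; ring
  have hle : ‖A‖ ≤ ∫ u : V, |Real.exp (s * ⟪w, u⟫_ℝ) - 1| * gaussWeight n α u := by
    refine (norm_integral_le_integral_norm _).trans (le_of_eq ?_)
    congr 1 with u
    have : Complex.exp ((s + Complex.I) * (⟪w, u⟫_ℝ : ℝ)) * (gaussWeight n α u : ℂ) -
        Complex.exp (Complex.I * (⟪w, u⟫_ℝ : ℝ)) * (gaussWeight n α u : ℂ) =
        Complex.exp ((⟪w, u⟫_ℝ : ℝ) * Complex.I) *
          (((Real.exp (s * ⟪w, u⟫_ℝ) - 1) * gaussWeight n α u : ℝ) : ℂ) := by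
      rw [add_mul, Complex.exp_add, mul_comm Complex.I]
      push_cast
      ring
    rw [this, norm_mul, Complex.norm_exp_ofReal_mul_I, one_mul, Complex.norm_real, norm_mul,
      Real.norm_eq_abs, Real.norm_of_nonneg (gaussWeight_nonneg n hα u)]
  refine le_trans ?_ hle
  rw [hAval, norm_mul, Complex.norm_real, Real.norm_of_nonneg (Real.exp_nonneg _)]
  gcongr
  refine le_trans ?_ ((le_abs_self _).trans (Complex.abs_im_le_norm _))
  rw [Complex.exp_add, ← Complex.ofReal_exp, Complex.sub_im, Complex.im_ofReal_mul,
    Complex.exp_ofReal_mul_I_im]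
  have : 1 ≤ Real.exp (s ^ 2 / (4 * α)) := Real.one_le_exp (by positivity)
  simp only [Complex.one_im, sub_zero]
  nlinarith

section ComplexExponent

variable {n : ℕ} {α β : ℝ} {z : V} {F : V → ℂ}

lemma integrable_norm_cexp_sub_one (n : ℕ) (hα : 0 < α) (hF : Continuous F)
    (hre : ∀ u, (F u).re = ⟪z, u⟫_ℝ) :
    Integrable fun u ↦ ‖Complex.exp (β * F u) - 1‖ * gaussWeight n α u := by
  refine ((integrable_exp_mul_gaussWeight n hα β z).add (integrable_gaussWeight n hα)).mono'
    (by unfold gaussWeight; fun_prop) (.of_forall fun u ↦ ?_)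
  have hg := gaussWeight_nonneg n hα u
  rw [Real.norm_of_nonneg (by positivity)]
  refine (mul_le_mul_of_nonneg_right (norm_sub_le _ _) hg).trans (le_of_eq ?_)
  rw [Complex.norm_exp, Complex.re_ofReal_mul, hre, norm_one]
  simp [add_mul]

lemma integral_norm_cexp_sub_one_le_exp_add_one (hn : Module.finrank ℝ V = 2 * n) (hα : 0 < α)
    (hF : Continuous F) (hre : ∀ u, (F u).re = ⟪z, u⟫_ℝ) :
    ∫ u, ‖Complex.exp (β * F u) - 1‖ * gaussWeight n α u ≤
      Real.exp (β ^ 2 * ‖z‖ ^ 2 / (4 * α)) + 1 := by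
  rw [← integral_exp_mul_gaussWeight hn hα, ← integral_gaussWeight (V := V) hn hα,
    ← integral_add (integrable_exp_mul_gaussWeight n hα β z) (integrable_gaussWeight n hα)]
  refine integral_mono (integrable_norm_cexp_sub_one n hα hF hre)
    ((integrable_exp_mul_gaussWeight n hα β z).add (integrable_gaussWeight n hα)) fun u ↦ ?_
  have hg := gaussWeight_nonneg n hα u
  refine (mul_le_mul_of_nonneg_right (norm_sub_le _ _) hg).trans (le_of_eq ?_)
  rw [Complex.norm_exp, Complex.re_ofReal_mul, hre, norm_one]
  ring

lemma integral_abs_exp_sub_one_le (n : ℕ) (hα : 0 < α)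
    (hF : Continuous F) (hre : ∀ u, (F u).re = ⟪z, u⟫_ℝ) :
    ∫ u, |Real.exp (β * ⟪z, u⟫_ℝ) - 1| * gaussWeight n α u ≤
      ∫ u, ‖Complex.exp (β * F u) - 1‖ * gaussWeight n α u := by
  refine integral_mono_of_nonneg
    (.of_forall fun u ↦ mul_nonneg (abs_nonneg _) (gaussWeight_nonneg n hα u))
    (integrable_norm_cexp_sub_one n hα hF hre) (.of_forall fun u ↦ ?_)
  refine mul_le_mul_of_nonneg_right ?_ (gaussWeight_nonneg n hα u)
  refine le_trans (le_of_eq ?_) (abs_norm_sub_norm_le _ _)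
  rw [Complex.norm_exp, Complex.re_ofReal_mul, hre, norm_one]

lemma exp_sub_one_le_integral_norm_cexp_sub_one (hn : Module.finrank ℝ V = 2 * n) (hα : 0 < α)
    (hF : Continuous F) (hre : ∀ u, (F u).re = ⟪z, u⟫_ℝ) :
    Real.exp (β ^ 2 * ‖z‖ ^ 2 / (4 * α)) - 1 ≤
      ∫ u, ‖Complex.exp (β * F u) - 1‖ * gaussWeight n α u := by
  rw [← integral_exp_mul_gaussWeight hn hα, ← integral_gaussWeight (V := V) hn hα,
    ← integral_sub (integrable_exp_mul_gaussWeight n hα β z) (integrable_gaussWeight n hα)]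
  refine integral_mono
    ((integrable_exp_mul_gaussWeight n hα β z).sub (integrable_gaussWeight n hα))
    (integrable_norm_cexp_sub_one n hα hF hre) fun u ↦ ?_
  dsimp only
  rw [← sub_one_mul]
  refine mul_le_mul_of_nonneg_right ?_ (gaussWeight_nonneg n hα u)
  refine le_trans (le_of_eq ?_) (norm_sub_norm_le _ _)
  rw [Complex.norm_exp, Complex.re_ofReal_mul, hre, norm_one]

lemma integral_norm_cexp_sub_one_le_mul (n : ℕ) (hα : 0 < α) (hβ : 0 ≤ β)
    (hF : Continuous F) (hre : ∀ u, (F u).re = ⟪z, u⟫_ℝ) (hnorm : ∀ u, ‖F u‖ ≤ ‖z‖ * ‖u‖)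
    {t : ℝ} (ht : β * ‖z‖ ≤ t) :
    ∫ u, ‖Complex.exp (β * F u) - 1‖ * gaussWeight n α u ≤
      β * ‖z‖ * ∫ u : V, ‖u‖ * Real.exp (t * ‖u‖) * gaussWeight n α u := by
  rw [← integral_const_mul]
  refine integral_mono (integrable_norm_cexp_sub_one n hα hF hre)
    ((integrable_norm_mul_exp_mul_gaussWeight n hα t).const_mul _) fun u ↦ ?_
  dsimp only
  rw [← mul_assoc]
  refine mul_le_mul_of_nonneg_right ?_ (gaussWeight_nonneg n hα u)
  have h := Complex.norm_exp_sub_sum_le_norm_mul_exp (β * F u) 1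
  have hle : ‖(β : ℂ) * F u‖ ≤ β * ‖z‖ * ‖u‖ := by
    rw [norm_mul, Complex.norm_real, Real.norm_of_nonneg hβ, mul_assoc]
    gcongr
    exact hnorm u
  simp only [Finset.range_one, Finset.sum_singleton, pow_zero, Nat.factorial_zero, Nat.cast_one,
    div_one, pow_one] at h
  calc ‖Complex.exp (β * F u) - 1‖ ≤ ‖(β : ℂ) * F u‖ * Real.exp ‖(β : ℂ) * F u‖ := h
    _ ≤ (β * ‖z‖ * ‖u‖) * Real.exp (t * ‖u‖) := by
        gcongr
        exact hle.trans (by gcongr)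
    _ = _ := by ring

lemma mul_le_integral_norm_cexp_sub_one (hn : Module.finrank ℝ V = 2 * n) (hα : 0 < α)
    (hβ : 0 ≤ β) (hF : Continuous F) (hre : ∀ u, (F u).re = ⟪z, u⟫_ℝ) (hz : β * ‖z‖ ≤ α) :
    Real.exp (-1 / (4 * α)) / (Real.pi * α) * (β * ‖z‖) ≤
      ∫ u, ‖Complex.exp (β * F u) - 1‖ * gaussWeight n α u := by
  refine le_trans ?_ (integral_abs_exp_sub_one_le n hα hF hre)
  rcases eq_or_ne z 0 with rfl | hz0
  · simp
  have hz' : ‖z‖ ≠ 0 := norm_ne_zero_iff.2 hz0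
  have hs : 0 ≤ β * ‖z‖ / (2 * α) := by positivity
  have hsin : 2 / Real.pi * (β * ‖z‖ / (2 * α)) ≤ Real.sin (β * ‖z‖ / (2 * α)) := by
    refine Real.mul_le_sin hs ?_
    have : β * ‖z‖ / (2 * α) ≤ 1 := by rw [div_le_one (by positivity)]; linarith
    linarith [Real.two_le_pi]
  have h := sin_le_integral_abs_exp_sub_one hn hα (s := β * ‖z‖) (w := ‖z‖⁻¹ • z)
    (by rw [norm_smul, norm_inv, norm_norm, inv_mul_cancel₀ hz'])
    (le_trans (by positivity) hsin)
  simp_rw [real_inner_smul_left, mul_assoc β, mul_inv_cancel_left₀ hz'] at h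
  refine le_trans ?_ h
  calc _ = Real.exp (-1 / (4 * α)) * (2 / Real.pi * (β * ‖z‖ / (2 * α))) := by field_simp
    _ ≤ _ := by gcongr

end ComplexExponent

end InnerProductSpace

section RealEstimates

lemma sub_one_le_sqrt_sq_sub_one {E : ℝ} (hE : 1 ≤ E) : E - 1 ≤ √(E ^ 2 - 1) :=
  Real.le_sqrt_of_sq_le (by nlinarith)

lemma sqrt_exp_sub_one_le (x : ℝ) : √(Real.exp x - 1) ≤ √(x * Real.exp x) := by
  refine Real.sqrt_le_sqrt ?_
  have h := mul_le_mul_of_nonneg_right (Real.add_one_le_exp (-x)) (Real.exp_nonneg x)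
  rw [← Real.exp_add, neg_add_cancel, Real.exp_zero] at h
  linarith

/-- Near the origin both quantities are linear in `s`; away from it both are comparable to
`e^{s²/(4α)}`. -/
lemma sqrt_exp_sub_one_equiv {ι : Type*} {α a K : ℝ} (hα : 0 < α) (ha : 0 < a) (hK : 0 ≤ K)
    (s D : ι → ℝ) (hs : ∀ i, 0 ≤ s i)
    (hlow : ∀ i, Real.exp (s i ^ 2 / (4 * α)) - 1 ≤ D i)
    (hupp : ∀ i, D i ≤ Real.exp (s i ^ 2 / (4 * α)) + 1)
    (hlow' : ∀ i, s i ≤ α → a * s i ≤ D i) (hupp' : ∀ i, s i ≤ α → D i ≤ s i * K) :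
    ∃ c > (0 : ℝ), ∃ C > (0 : ℝ), ∀ i,
      c * √(Real.exp (s i ^ 2 / (2 * α)) - 1) ≤ D i ∧
      D i ≤ C * √(Real.exp (s i ^ 2 / (2 * α)) - 1) := by
  set q := 1 - Real.exp (-(α / 4)) with hq
  have hq0 : 0 < q := by
    have : Real.exp (-(α / 4)) < 1 := Real.exp_lt_one_iff.2 (by linarith)
    linarith
  set B := √(Real.exp (α / 2) / (2 * α)) with hB
  have hB0 : 0 < B := by positivity
  refine ⟨min q (a / B), by positivity, max (2 / q) (K * √(2 * α)), by positivity, fun i ↦ ?_⟩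
  set S := √(Real.exp (s i ^ 2 / (2 * α)) - 1) with hS
  have hS0 : 0 ≤ S := Real.sqrt_nonneg _
  rcases le_total (s i) α with h | h
  · have hx : s i ^ 2 / (2 * α) ≤ α / 2 := by
      rw [div_le_div_iff₀ (by positivity) two_pos]; nlinarith [hs i]
    have h1 : S ≤ B * s i := by
      refine (sqrt_exp_sub_one_le _).trans ?_
      rw [← Real.sqrt_sq (hs i), ← Real.sqrt_mul (by positivity), Real.sqrt_sq (hs i)]
      refine Real.sqrt_le_sqrt ?_
      calc s i ^ 2 / (2 * α) * Real.exp (s i ^ 2 / (2 * α))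
          ≤ s i ^ 2 / (2 * α) * Real.exp (α / 2) := by gcongr
        _ = _ := by ring
    have h2 : s i ≤ √(2 * α) * S := by
      rw [hS, ← Real.sqrt_mul (by positivity)]
      refine Real.le_sqrt_of_sq_le ?_
      have := Real.add_one_le_exp (s i ^ 2 / (2 * α))
      calc s i ^ 2 = 2 * α * (s i ^ 2 / (2 * α)) := by field_simp
        _ ≤ _ := by gcongr; linarith
    constructor
    · calc min q (a / B) * S ≤ a / B * (B * s i) := by gcongr; exact min_le_right _ _
        _ = a * s i := by field_simp
        _ ≤ D i := hlow' i h
    · calc D i ≤ s i * K := hupp' i h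
        _ ≤ √(2 * α) * S * K := by gcongr
        _ = K * √(2 * α) * S := by ring
        _ ≤ _ := by gcongr; exact le_max_right _ _
  · set E := Real.exp (s i ^ 2 / (4 * α)) with hE
    have hE1 : 1 ≤ E := Real.one_le_exp (by positivity)
    have hSE : S = √(E ^ 2 - 1) := by
      rw [hS, hE, ← Real.exp_nat_mul]
      congr 3
      push_cast
      ring
    have hqE : q * E ≤ E - 1 := by
      have : 1 ≤ Real.exp (-(α / 4)) * E := by
        rw [hE, ← Real.exp_add]
        refine Real.one_le_exp ?_
        have : α / 4 ≤ s i ^ 2 / (4 * α) := by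
          rw [div_le_div_iff₀ (by norm_num) (by positivity)]; nlinarith
        linarith
      rw [hq]; linarith
    have hS1 : E - 1 ≤ S := hSE ▸ sub_one_le_sqrt_sq_sub_one hE1
    have hS2 : S ≤ E := hSE ▸ Real.sqrt_le_iff.2 ⟨by linarith, by linarith⟩
    constructor
    · calc min q (a / B) * S ≤ q * E := by gcongr; exact min_le_left _ _
        _ ≤ D i := hqE.trans (hlow i)
    · calc D i ≤ 2 * E := by linarith [hupp i]
        _ = 2 / q * (q * E) := by field_simp
        _ ≤ 2 / q * S := by gcongr; linarith
        _ ≤ _ := by gcongr; exact le_max_left _ _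

end RealEstimates

lemma finrank_real_euclideanSpace_complex (n : ℕ) :
    Module.finrank ℝ (EuclideanSpace ℂ (Fin n)) = 2 * n := by
  rw [← Module.finrank_mul_finrank ℝ ℂ, Complex.finrank_real_complex, finrank_euclideanSpace_fin]

lemma re_inner_euclideanSpace_complex {n : ℕ} (z u : EuclideanSpace ℂ (Fin n)) :
    (⟪u, z⟫_ℂ).re = ⟪z, u⟫_ℝ := by
  simp only [PiLp.inner_apply, Complex.re_sum]
  refine Finset.sum_congr rfl fun i _ ↦ ?_
  simp [Complex.inner, mul_comm]

theorem stmt2 (n : ℕ) (α β : ℝ) (hα : 0 < α) (hβ : 0 < β) :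
    ∃ c > (0 : ℝ), ∃ C > (0 : ℝ), ∀ z : EuclideanSpace ℂ (Fin n),
      c * Real.sqrt (Real.exp (β ^ 2 * ‖z‖ ^ 2 / (2 * α)) - 1) ≤ dAB n α β z 0 ∧
      dAB n α β z 0 ≤ C * Real.sqrt (Real.exp (β ^ 2 * ‖z‖ ^ 2 / (2 * α)) - 1) := by
  let : MeasurableSpace (EuclideanSpace ℂ (Fin n)) := borel _
  have : BorelSpace (EuclideanSpace ℂ (Fin n)) := ⟨rfl⟩
  have hn := finrank_real_euclideanSpace_complex n
  have hF (z : EuclideanSpace ℂ (Fin n)) : Continuous fun u ↦ ⟪u, z⟫_ℂ := by fun_prop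
  have hre (z u : EuclideanSpace ℂ (Fin n)) := re_inner_euclideanSpace_complex z u
  have hnorm (z u : EuclideanSpace ℂ (Fin n)) : ‖⟪u, z⟫_ℂ‖ ≤ ‖z‖ * ‖u‖ :=
    (norm_inner_le_norm u z).trans_eq (mul_comm _ _)
  have hd (z : EuclideanSpace ℂ (Fin n)) : dAB n α β z 0 =
      ∫ u, ‖Complex.exp (β * ⟪u, z⟫_ℂ) - 1‖ * gaussWeight n α u
        ∂(measureSpaceOfInnerProductSpace (E := EuclideanSpace ℂ (Fin n))).volume := by
    unfold dAB
    simp only [inner_zero_right, mul_zero, Complex.exp_zero]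
    rfl
  simp_rw [← mul_pow]
  refine sqrt_exp_sub_one_equiv hα (a := Real.exp (-1 / (4 * α)) / (Real.pi * α))
    (K := ∫ u : EuclideanSpace ℂ (Fin n), ‖u‖ * Real.exp (α * ‖u‖) * gaussWeight n α u
        ∂(measureSpaceOfInnerProductSpace (E := EuclideanSpace ℂ (Fin n))).volume)
    (by positivity) (integral_nonneg fun u ↦ ?_) (fun z ↦ β * ‖z‖) (fun z ↦ dAB n α β z 0)
    (fun z ↦ by positivity) (fun z ↦ ?_) (fun z ↦ ?_) (fun z hz ↦ ?_) (fun z hz ↦ ?_)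
  · have := gaussWeight_nonneg n hα u
    positivity
  · rw [hd, mul_pow]
    exact exp_sub_one_le_integral_norm_cexp_sub_one hn hα (hF z) (hre z)
  · rw [hd, mul_pow]
    exact integral_norm_cexp_sub_one_le_exp_add_one hn hα (hF z) (hre z)
  · rw [hd]
    exact mul_le_integral_norm_cexp_sub_one hn hα hβ.le (hF z) (hre z) hz
  · rw [hd]
    exact integral_norm_cexp_sub_one_le_mul n hα hβ.le (hF z) (hre z) (hnorm z) hz
end

section
/- For all α > 0 and all z ∈ ℂⁿ, (α/2) ∫_{ℂⁿ} |u|² |e^{α z·ū}| dλ_{α/2}(u) = (n + (α/2)|z|²) e^{α|z|²/2}. -/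
open MeasureTheory
open scoped InnerProductSpace

namespace GaussianMoment

open Set Module

/-- The recursion relating two consecutive even moments of a Gaussian on the half line. -/
lemma integral_Ioi_pow_mul_sq_mul_exp {b : ℝ} (hb : 0 < b) {d : ℕ} (hd : 0 < d) :
    ∫ y in Ioi (0 : ℝ), y ^ (d - 1) * (y ^ 2 * Real.exp (-b * y ^ 2)) =
      d / (2 * b) * ∫ y in Ioi (0 : ℝ), y ^ (d - 1) * Real.exp (-b * y ^ 2) := by
  obtain ⟨k, rfl⟩ : ∃ k, d = k + 1 := ⟨d - 1, by omega⟩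
  have hmoment (m : ℕ) : ∫ y in Ioi (0 : ℝ), y ^ m * Real.exp (-b * y ^ 2) =
      b ^ (-((m : ℝ) + 1) / 2) * (1 / 2) * Real.Gamma (((m : ℝ) + 1) / 2) := by
    rw [← integral_rpow_mul_exp_neg_mul_rpow two_pos
      (by linarith [(Nat.cast_nonneg m : (0 : ℝ) ≤ m)]) hb]
    simp only [Real.rpow_natCast, Real.rpow_two]
  simp only [Nat.add_sub_cancel, ← mul_assoc, ← pow_add]
  rw [hmoment, hmoment]
  push_cast
  rw [show ((k : ℝ) + 2 + 1) / 2 = ((k : ℝ) + 1) / 2 + 1 by ring,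
    Real.Gamma_add_one (by positivity),
    show -((k : ℝ) + 2 + 1) / 2 = -((k : ℝ) + 1) / 2 - 1 by ring, Real.rpow_sub_one hb.ne']
  field_simp

section Haar

variable {V : Type*} [NormedAddCommGroup V] [NormedSpace ℝ V] [FiniteDimensional ℝ V]
  [MeasurableSpace V] [BorelSpace V] (μ : Measure V) [μ.IsAddHaarMeasure]

lemma integrable_norm_pow_mul_exp_neg_mul_sq_norm {b : ℝ} (hb : 0 < b) (m : ℕ) :
    Integrable (fun v ↦ ‖v‖ ^ m * Real.exp (-b * ‖v‖ ^ 2)) μ := by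
  cases subsingleton_or_nontrivial V with
  | inl h =>
    have : (fun v : V ↦ ‖v‖ ^ m * Real.exp (-b * ‖v‖ ^ 2)) =
        fun _ ↦ ‖(0 : V)‖ ^ m * Real.exp (-b * ‖(0 : V)‖ ^ 2) := by
      funext v; rw [Subsingleton.elim v 0]
    rw [this, ← integrableOn_univ]
    exact integrableOn_const (Set.finite_univ.isCompact.measure_lt_top.ne)
  | inr h =>
    refine (integrable_fun_norm_addHaar μ
      (f := fun y ↦ y ^ m * Real.exp (-b * y ^ 2))).2 ?_
    have := integrableOn_rpow_mul_exp_neg_mul_sq hb (s := ((finrank ℝ V - 1 + m : ℕ) : ℝ))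
      (neg_one_lt_zero.trans_le (Nat.cast_nonneg _))
    simpa only [Real.rpow_natCast, pow_add, smul_eq_mul, mul_assoc] using this

lemma integral_sq_norm_mul_exp_neg_mul_sq_norm {b : ℝ} (hb : 0 < b) :
    ∫ v, ‖v‖ ^ 2 * Real.exp (-b * ‖v‖ ^ 2) ∂μ =
      finrank ℝ V / (2 * b) * ∫ v, Real.exp (-b * ‖v‖ ^ 2) ∂μ := by
  cases subsingleton_or_nontrivial V with
  | inl h =>
    have hz (v : V) : ‖v‖ = 0 := by rw [Subsingleton.elim v 0, norm_zero]
    simp [hz, finrank_zero_of_subsingleton]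
  | inr h =>
    rw [integral_fun_norm_addHaar μ (fun y ↦ y ^ 2 * Real.exp (-b * y ^ 2)),
      integral_fun_norm_addHaar μ (fun y ↦ Real.exp (-b * y ^ 2))]
    simp only [smul_eq_mul, nsmul_eq_mul]
    rw [integral_Ioi_pow_mul_sq_mul_exp hb finrank_pos]
    ring

end Haar

section InnerProduct

variable {V : Type*} [NormedAddCommGroup V] [InnerProductSpace ℝ V] [FiniteDimensional ℝ V]
  [MeasurableSpace V] [BorelSpace V] (μ : Measure V) [μ.IsAddHaarMeasure]

/-- The linear term of `‖v + z‖ ^ 2` integrates to zero against a centred Gaussian. -/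
lemma integral_sq_norm_add_mul_exp_neg_mul_sq_norm {b : ℝ} (hb : 0 < b) (z : V) :
    ∫ v, ‖v + z‖ ^ 2 * Real.exp (-b * ‖v‖ ^ 2) ∂μ =
      (finrank ℝ V / (2 * b) + ‖z‖ ^ 2) * ∫ v, Real.exp (-b * ‖v‖ ^ 2) ∂μ := by
  have h2 := integrable_norm_pow_mul_exp_neg_mul_sq_norm μ hb 2
  have h1 := integrable_norm_pow_mul_exp_neg_mul_sq_norm μ hb 1
  have h0 : Integrable (fun v ↦ Real.exp (-b * ‖v‖ ^ 2)) μ := by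
    simpa using integrable_norm_pow_mul_exp_neg_mul_sq_norm μ hb 0
  have hin : Integrable (fun v ↦ inner ℝ v z * Real.exp (-b * ‖v‖ ^ 2)) μ := by
    refine (h1.const_mul ‖z‖).mono' (by fun_prop) (.of_forall fun v ↦ ?_)
    rw [norm_mul, Real.norm_of_nonneg (Real.exp_pos _).le, pow_one, ← mul_assoc, mul_comm ‖z‖]
    gcongr
    exact norm_inner_le_norm v z
  have hodd : ∫ v, inner ℝ v z * Real.exp (-b * ‖v‖ ^ 2) ∂μ = 0 := by
    have := integral_neg_eq_self (fun v ↦ inner ℝ v z * Real.exp (-b * ‖v‖ ^ 2)) μ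
    simp only [inner_neg_left, norm_neg, neg_mul, integral_neg] at this ⊢
    linarith
  have hexpand (v : V) : ‖v + z‖ ^ 2 * Real.exp (-b * ‖v‖ ^ 2) =
      ‖v‖ ^ 2 * Real.exp (-b * ‖v‖ ^ 2) + 2 * (inner ℝ v z * Real.exp (-b * ‖v‖ ^ 2)) +
        ‖z‖ ^ 2 * Real.exp (-b * ‖v‖ ^ 2) := by
    rw [norm_add_sq_real]; ring
  simp_rw [hexpand]
  rw [integral_add (by exact h2.add (hin.const_mul 2)) (h0.const_mul _),
    integral_add h2 (hin.const_mul 2), integral_const_mul, integral_const_mul, hodd,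
    integral_sq_norm_mul_exp_neg_mul_sq_norm μ hb]
  ring

lemma integral_sq_norm_mul_exp_inner_mul_exp_neg_mul_sq_norm {b : ℝ} (hb : 0 < b) (z : V) :
    ∫ v, ‖v‖ ^ 2 * Real.exp (2 * b * inner ℝ v z) * Real.exp (-b * ‖v‖ ^ 2) ∂μ =
      (finrank ℝ V / (2 * b) + ‖z‖ ^ 2) * Real.exp (b * ‖z‖ ^ 2) *
        ∫ v, Real.exp (-b * ‖v‖ ^ 2) ∂μ := by
  rw [← integral_add_right_eq_self _ z, mul_right_comm,
    ← integral_sq_norm_add_mul_exp_neg_mul_sq_norm μ hb, ← integral_mul_const]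
  congr 1 with v
  have hexponent : 2 * b * inner ℝ (v + z) z + -b * ‖v + z‖ ^ 2 =
      -b * ‖v‖ ^ 2 + b * ‖z‖ ^ 2 := by
    rw [norm_add_sq_real, inner_add_left, real_inner_self_eq_norm_sq]
    ring
  rw [mul_assoc, ← Real.exp_add, hexponent, Real.exp_add, ← mul_assoc]

end InnerProduct

end GaussianMoment

theorem stmt5 (n : ℕ) (α : ℝ) (hα : 0 < α) (z : EuclideanSpace ℂ (Fin n)) :
    (α / 2) * ∫ u, ‖u‖ ^ 2 * ‖Complex.exp ((α : ℂ) * ⟪u, z⟫_ℂ)‖ *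
        gaussDensity n (α / 2) u =
      ((n : ℝ) + (α / 2) * ‖z‖ ^ 2) * Real.exp (α * ‖z‖ ^ 2 / 2) := by
  let : MeasurableSpace (EuclideanSpace ℂ (Fin n)) := borel (EuclideanSpace ℂ (Fin n))
  have : BorelSpace (EuclideanSpace ℂ (Fin n)) := ⟨rfl⟩
  have hb : 0 < α / 2 := half_pos hα
  have hfin : Module.finrank ℝ (EuclideanSpace ℂ (Fin n)) = 2 * n := by
    rw [← Module.finrank_mul_finrank ℝ ℂ (EuclideanSpace ℂ (Fin n)), Complex.finrank_real_complex,
      finrank_euclideanSpace, Fintype.card_fin]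
  have hgauss : ∫ u : EuclideanSpace ℂ (Fin n), Real.exp (-(α / 2) * ‖u‖ ^ 2) =
      (Real.pi / (α / 2)) ^ n := by
    rw [GaussianFourier.integral_rexp_neg_mul_sq_norm hb, hfin]
    push_cast
    rw [mul_div_cancel_left₀ _ two_ne_zero, Real.rpow_natCast]
  have hinner (u : EuclideanSpace ℂ (Fin n)) : inner ℝ u z = (⟪u, z⟫_ℂ).re := by
    simp [PiLp.inner_apply, Complex.inner]
  have hintegrand (u : EuclideanSpace ℂ (Fin n)) : ‖u‖ ^ 2 * ‖Complex.exp ((α : ℂ) * ⟪u, z⟫_ℂ)‖ *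
      gaussDensity n (α / 2) u = (α / 2 / Real.pi) ^ n * (‖u‖ ^ 2 *
        Real.exp (2 * (α / 2) * inner ℝ u z) * Real.exp (-(α / 2) * ‖u‖ ^ 2)) := by
    rw [Complex.norm_exp, Complex.re_ofReal_mul, gaussDensity, mul_div_cancel₀ _ two_ne_zero, hinner]
    ring
  have hmain := GaussianMoment.integral_sq_norm_mul_exp_inner_mul_exp_neg_mul_sq_norm
    (volume : Measure (EuclideanSpace ℂ (Fin n))) hb z
  have hcancel : (α / 2 / Real.pi) ^ n * (Real.pi / (α / 2)) ^ n = 1 := by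
    rw [← mul_pow, div_mul_div_cancel₀ Real.pi_ne_zero, div_self hb.ne', one_pow]
  rw [integral_congr_ae (.of_forall hintegrand), integral_const_mul, hmain, hgauss, hfin]
  push_cast
  calc
    _ = (α / 2 / Real.pi) ^ n * (Real.pi / (α / 2)) ^ n *
        ((α / 2 * (2 * n / (2 * (α / 2))) + α / 2 * ‖z‖ ^ 2) * Real.exp (α / 2 * ‖z‖ ^ 2)) := by
      ring
    _ = _ := by
      rw [hcancel, one_mul, mul_div_mul_left _ _ two_ne_zero, mul_div_cancel₀ _ hb.ne',
        div_mul_eq_mul_div]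
end
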